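/- Suppose the limit L := lim_{ρ→0⁺} ρ f''(ρ)/f'(ρ) exists and is finite. Then L = 0. -/

import Mathlib

open Set MeasureTheory Metric Filter
open scoped Topology

noncomputable section

/-- The (one-sided at `0`) derivative of `f` on `[0,∞)`. -/
def dtop (f : ℝ → ℝ) : ℝ → ℝ := derivWithin f (Set.Ici 0)

/-- Standing assumptions on the Lagrangian `f` : strictly convex on `[0,∞)`, `C¹` on `[0,∞)`,
`C²` on `(0,∞)` with `f''` locally Hölder continuous of some exponent `λ ∈ (0,1)`,
and `f'(0) > 0`. -/
def StdF (f : ℝ → ℝ) : Prop :=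
  StrictConvexOn ℝ (Set.Ici 0) f ∧ ContDiffOn ℝ 1 f (Set.Ici 0) ∧
  ContDiffOn ℝ 2 f (Set.Ioi 0) ∧
  (∃ lam : NNReal, 0 < lam ∧ lam < 1 ∧ ∀ K : Set ℝ, IsCompact K → K ⊆ Set.Ioi 0 →
    ∃ C : NNReal, HolderOnWith C lam (deriv (dtop f)) K) ∧
  0 < dtop f 0

theorem StdF.continuousOn_dtop {f : ℝ → ℝ} (hf : StdF f) : ContinuousOn (dtop f) (Ici 0) :=
  hf.2.1.continuousOn_derivWithin (uniqueDiffOn_Ici 0) le_rfl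

theorem StdF.differentiableAt_dtop {f : ℝ → ℝ} (hf : StdF f) {x : ℝ} (hx : 0 < x) :
    DifferentiableAt ℝ (dtop f) x := by
  have hd : DifferentiableOn ℝ (deriv f) (Ioi 0) :=
    (hf.2.2.1.deriv_of_isOpen (m := 1) isOpen_Ioi (by norm_num)).differentiableOn one_ne_zero
  refine (hd.differentiableAt (Ioi_mem_nhds hx)).congr_of_eventuallyEq ?_
  filter_upwards [Ioi_mem_nhds hx] with y hy
  exact derivWithin_of_mem_nhds (Ici_mem_nhds hy)

/-- If `g` is continuous from the right at `0` and `x * g' x` has a limit as `x → 0⁺`, that limit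
is `0`: both `g 0` and `g 0 + l` are the right derivative of `x * g x` at `0`. -/
theorem eq_zero_of_tendsto_mul_deriv {g : ℝ → ℝ} {l : ℝ} (hg : ContinuousWithinAt g (Ici 0) 0)
    (hd : ∀ x, 0 < x → DifferentiableAt ℝ g x)
    (hl : Tendsto (fun x => x * deriv g x) (𝓝[>] 0) (𝓝 l)) : l = 0 := by
  have hg' : Tendsto g (𝓝[>] 0) (𝓝 (g 0)) := hg.mono Ioi_subset_Ici_self
  have h_lim : HasDerivWithinAt (fun x => x * g x) (g 0 + l) (Ici 0) 0 := by
    refine hasDerivWithinAt_Ici_of_tendsto_deriv (s := Ioi 0)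
      (fun x hx => (differentiableAt_id.mul (hd x hx)).differentiableWithinAt)
      (continuousWithinAt_id.mul (hg.mono Ioi_subset_Ici_self)) self_mem_nhdsWithin
      ((hg'.add hl).congr' ?_)
    filter_upwards [self_mem_nhdsWithin] with x hx
    have := ((hasDerivAt_id x).mul (hd x hx).hasDerivAt).deriv
    simpa [Pi.mul_def] using this.symm
  have h_slope : HasDerivWithinAt (fun x => x * g x) (g 0) (Ici 0) 0 := by
    rw [hasDerivWithinAt_iff_tendsto_slope, Ici_sdiff_left]
    refine hg'.congr' ?_
    filter_upwards [self_mem_nhdsWithin] with x hx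
    have hx' : x ≠ 0 := ne_of_gt hx
    simp [slope_def_field, hx']
  have := (uniqueDiffOn_Ici (0 : ℝ) 0 self_mem_Ici).eq_deriv _ h_lim h_slope
  linarith

/-- If the limit `L = lim_{ρ→0⁺} ρ f''(ρ)/f'(ρ)` exists and is finite,
then `L = 0`. -/
theorem limit_of_alpha_at_zero_is_zero
    (f : ℝ → ℝ) (hf : StdF f)
    (L : ℝ)
    (hlim : Tendsto (fun ρ => ρ * deriv (dtop f) ρ / dtop f ρ)
      (nhdsWithin 0 (Set.Ioi 0)) (nhds L)) :
    L = 0 := by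
  have hc : ContinuousWithinAt (dtop f) (Ici 0) 0 := hf.continuousOn_dtop 0 self_mem_Ici
  have hpos : 0 < dtop f 0 := hf.2.2.2.2
  have hg : Tendsto (dtop f) (𝓝[>] 0) (𝓝 (dtop f 0)) := hc.mono Ioi_subset_Ici_self
  have hl : Tendsto (fun ρ => ρ * deriv (dtop f) ρ) (𝓝[>] 0) (𝓝 (L * dtop f 0)) := by
    refine (hlim.mul hg).congr' ?_
    filter_upwards [hg.eventually (lt_mem_nhds hpos)] with x hx
    exact div_mul_cancel₀ _ hx.ne'
  have := eq_zero_of_tendsto_mul_deriv hc (fun _ => hf.differentiableAt_dtop) hl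
  exact (mul_eq_zero.mp this).resolve_right hpos.ne'
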